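/- arXiv:2306.00350 — 2 statements merged into one kernel-verified Lean document; each statement's English description precedes it below -/
import Mathlib

section
/- Cocoercivity (strong monotonicity in the image) of the softmax map: for all y, y′ : A → ℝ, Σ_a (y(a) − y′(a)) (σ(y)(a) − σ(y′)(a)) ≥ ε Σ_a (σ(y)(a) − σ(y′)(a))². -/
open scoped BigOperators

noncomputable section

/-- Softmax choice map with regularization parameter `ε`:
`σ(y)(a) = exp(y a / ε) / ∑_b exp(y b / ε)`. -/
def softmax {A : Type*} [Fintype A] (ε : ℝ) (y : A → ℝ) (a : A) : ℝ :=
  Real.exp (y a / ε) / ∑ b, Real.exp (y b / ε)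

/-- Negative Gibbs entropy `H(p) = ∑_a p a * log (p a)` (with `0 · log 0 = 0`). -/
def negEnt {A : Type*} [Fintype A] (p : A → ℝ) : ℝ := ∑ a, p a * Real.log (p a)

theorem aux_log {p q : ℝ} (hp : 0 < p) (hq : 0 < q) (hp1 : p ≤ 1) (h : q ≤ p) :
    p - q ≤ Real.log p - Real.log q := by
  have h1 := Real.log_le_sub_one_of_pos (div_pos hq hp)
  rw [Real.log_div hq.ne' hp.ne'] at h1
  have h2 : p - q ≤ (p - q) / p := by
    rw [le_div_iff₀ hp]
    nlinarith
  have h3 : (p - q) / p = 1 - q / p := by field_simp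
  linarith

theorem aux_sq {p q : ℝ} (hp : 0 < p) (hq : 0 < q) (hp1 : p ≤ 1) (hq1 : q ≤ 1) :
    (p - q) ^ 2 ≤ (Real.log p - Real.log q) * (p - q) := by
  rcases le_total q p with h | h
  · nlinarith [aux_log hp hq hp1 h]
  · nlinarith [aux_log hq hp hq1 h]

theorem aux_Z {A : Type*} [Fintype A] [Nonempty A] (ε : ℝ) (y : A → ℝ) :
    0 < ∑ b, Real.exp (y b / ε) :=
  Finset.sum_pos (fun _ _ => Real.exp_pos _) Finset.univ_nonempty

theorem aux_pos {A : Type*} [Fintype A] [Nonempty A] (ε : ℝ) (y : A → ℝ) (a : A) :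
    0 < softmax ε y a := div_pos (Real.exp_pos _) (aux_Z ε y)

theorem aux_sum {A : Type*} [Fintype A] [Nonempty A] (ε : ℝ) (y : A → ℝ) :
    ∑ a, softmax ε y a = 1 := by
  unfold softmax
  rw [← Finset.sum_div, div_self (aux_Z ε y).ne']

theorem aux_le {A : Type*} [Fintype A] [Nonempty A] (ε : ℝ) (y : A → ℝ) (a : A) :
    softmax ε y a ≤ 1 := by
  rw [← aux_sum ε y]
  exact Finset.single_le_sum (f := softmax ε y) (fun b _ => (aux_pos ε y b).le)
    (Finset.mem_univ a)

theorem aux_y {A : Type*} [Fintype A] [Nonempty A] (ε : ℝ) (hε : 0 < ε) (y : A → ℝ) (a : A) :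
    y a = ε * (Real.log (softmax ε y a) + Real.log (∑ b, Real.exp (y b / ε))) := by
  unfold softmax
  rw [Real.log_div (Real.exp_pos _).ne' (aux_Z ε y).ne', Real.log_exp]
  field_simp
  ring

/-- **Cocoercivity of the softmax map.**  For all `y, y' : A → ℝ`:
`∑_a (y a − y' a)(σ(y)(a) − σ(y')(a)) ≥ ε ∑_a (σ(y)(a) − σ(y')(a))²`. -/
theorem softmax_cocoercive {A : Type*} [Fintype A] [Nonempty A]
    (ε : ℝ) (hε : 0 < ε) (y y' : A → ℝ) :
    ∑ a, (y a - y' a) * (softmax ε y a - softmax ε y' a) ≥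
      ε * ∑ a, (softmax ε y a - softmax ε y' a) ^ 2 := by
  set c := Real.log (∑ b, Real.exp (y b / ε)) - Real.log (∑ b, Real.exp (y' b / ε)) with hc
  have key : ∑ a, (y a - y' a) * (softmax ε y a - softmax ε y' a) =
      ε * ∑ a, (Real.log (softmax ε y a) - Real.log (softmax ε y' a)) *
        (softmax ε y a - softmax ε y' a) := by
    have h0 : ∑ a, ε * c * (softmax ε y a - softmax ε y' a) = 0 := by
      rw [← Finset.mul_sum, Finset.sum_sub_distrib, aux_sum, aux_sum]; ring
    rw [← add_zero (ε * _), ← h0, Finset.mul_sum, ← Finset.sum_add_distrib]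
    refine Finset.sum_congr rfl fun a _ => ?_
    have e1 := aux_y ε hε y a
    have e2 := aux_y ε hε y' a
    have e3 : y a - y' a =
      ε * (Real.log (softmax ε y a) - Real.log (softmax ε y' a)) + ε * c := by
      rw [hc]; linarith
    rw [e3]; ring
  rw [key]
  exact mul_le_mul_of_nonneg_left (Finset.sum_le_sum fun a _ =>
    aux_sq (aux_pos ε y a) (aux_pos ε y' a) (aux_le ε y a) (aux_le ε y' a)) hε.le
end
end

section
/- Fenchel-coupling lower bound by policy distance: define F(p, y) = ε log( Σ_b exp(y(b)/ε) ) + ε H(p) − Σ_a p(a) y(a) for p ∈ Δ(A) and y : A → ℝ. Then F(p, y) ≥ (ε/2) ( Σ_a |p(a) − σ(y)(a)| )²; in particular F(p, y) ≥ (ε/2) Σ_a (p(a) − σ(y)(a))². -/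
open scoped BigOperators

noncomputable section

lemma aux_hasDeriv (t : ℝ) (ht : 0 < t) :
    HasDerivAt (fun t : ℝ => Real.log t - (5*t^2-4*t-1)/(2*t^2+4*t))
      ((t-1)^3/(t^2*(t+2)^2)) t := by
  have h1 := Real.hasDerivAt_log ht.ne'
  have h2 : HasDerivAt (fun t : ℝ => 5*t^2-4*t-1) (10*t-4) t := by
    have := (((hasDerivAt_pow 2 t).const_mul 5).sub ((hasDerivAt_id t).const_mul 4)).sub_const 1
    exact this.congr_deriv (by norm_num; try ring)
  have h3 : HasDerivAt (fun t : ℝ => 2*t^2+4*t) (4*t+4) t := by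
    have := (((hasDerivAt_pow 2 t).const_mul 2).add ((hasDerivAt_id t).const_mul 4))
    exact this.congr_deriv (by norm_num; try ring)
  have h4 : 2*t^2+4*t ≠ 0 := by positivity
  refine (h1.sub (h2.div h3 h4)).congr_deriv ?_
  have : t + 2 ≠ 0 := by positivity
  have h5 : 2*t^2+4*t = 2*t*(t+2) := by ring
  rw [h5]
  field_simp
  ring

lemma aux_log_s17 (t : ℝ) (ht : 0 < t) : (5*t^2-4*t-1)/(2*t^2+4*t) ≤ Real.log t := by
  set f : ℝ → ℝ := fun t : ℝ => Real.log t - (5*t^2-4*t-1)/(2*t^2+4*t) with hf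
  have f1 : f 1 = 0 := by norm_num [hf]
  suffices h : f 1 ≤ f t by
    rw [f1] at h
    exact sub_nonneg.mp h
  rcases le_total t 1 with h | h
  · have : AntitoneOn f (Set.Ioc 0 1) := by
      apply antitoneOn_of_deriv_nonpos (convex_Ioc 0 1)
      · exact fun x hx => (aux_hasDeriv x hx.1).continuousAt.continuousWithinAt
      · intro x hx
        rw [interior_Ioc] at hx
        exact (aux_hasDeriv x hx.1).differentiableAt.differentiableWithinAt
      · intro x hx
        rw [interior_Ioc] at hx
        rw [(aux_hasDeriv x hx.1).deriv]
        apply div_nonpos_of_nonpos_of_nonneg _ (by positivity)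
        have h1 : x - 1 ≤ 0 := by linarith [hx.2]
        exact Odd.pow_nonpos (by decide) h1
    exact this ⟨ht, h⟩ ⟨one_pos, le_rfl⟩ h
  · have : MonotoneOn f (Set.Ici 1) := by
      have hpos : ∀ x : ℝ, 1 < x → 0 < x := fun x hx => by linarith
      apply monotoneOn_of_deriv_nonneg (convex_Ici 1)
      · exact fun x hx => (aux_hasDeriv x (lt_of_lt_of_le one_pos hx)).continuousAt.continuousWithinAt
      · intro x hx
        rw [interior_Ici] at hx
        exact (aux_hasDeriv x (hpos x hx)).differentiableAt.differentiableWithinAt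
      · intro x hx
        rw [interior_Ici] at hx
        rw [(aux_hasDeriv x (hpos x hx)).deriv]
        have h1 : 0 ≤ x - 1 := by linarith [Set.mem_Ioi.mp hx]
        positivity
    exact this Set.self_mem_Ici h h

lemma aux_term (p q : ℝ) (hp : 0 ≤ p) (hq : 0 < q) :
    (p - q)^2 ≤ ((2*p+4*q)/3) * (p * Real.log p - p * Real.log q - p + q) := by
  rcases hp.eq_or_lt with rfl | hp
  · simp; nlinarith [sq_nonneg q]
  have h := aux_log_s17 (p/q) (by positivity)
  rw [Real.log_div hp.ne' hq.ne'] at h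
  have e : (5*(p/q)^2-4*(p/q)-1)/(2*(p/q)^2+4*(p/q)) = (5*p^2-4*p*q-q^2)/(2*p*(p+2*q)) := by
    field_simp
    ring
  rw [e, div_le_iff₀ (by positivity)] at h
  nlinarith

lemma aux_pinsker {A : Type*} [Fintype A] (p q : A → ℝ) (hp : ∀ a, 0 ≤ p a) (hq : ∀ a, 0 < q a)
    (hp1 : ∑ a, p a = 1) (hq1 : ∑ a, q a = 1) :
    (∑ a, |p a - q a|)^2 ≤ 2 * ∑ a, (p a * Real.log (p a) - p a * Real.log (q a)) := by
  have key : ∀ a, 0 ≤ p a * Real.log (p a) - p a * Real.log (q a) - p a + q a := fun a => by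
    have h := aux_term (p a) (q a) (hp a) (hq a)
    have h2 : 0 < (2 * p a + 4 * q a)/3 := by have := hp a; have := hq a; positivity
    exact nonneg_of_mul_nonneg_right ((sq_nonneg _).trans h) h2
  have h := Finset.sum_sq_le_sum_mul_sum_of_sq_le_mul Finset.univ (r := fun a => |p a - q a|)
    (f := fun a => (2 * p a + 4 * q a)/3)
    (g := fun a => p a * Real.log (p a) - p a * Real.log (q a) - p a + q a)
    (fun a _ => by have := hp a; have := hq a; positivity) (fun a _ => key a)
    (fun a _ => by rw [sq_abs]; exact aux_term _ _ (hp a) (hq a))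
  have e1 : ∑ a, (2 * p a + 4 * q a)/3 = 2 := by
    rw [← Finset.sum_div, Finset.sum_add_distrib, ← Finset.mul_sum, ← Finset.mul_sum, hp1, hq1]
    norm_num
  rw [e1, Finset.sum_add_distrib, Finset.sum_sub_distrib, hp1, hq1] at h
  linarith

/-- **Fenchel-coupling lower bound by policy distance.**  With
`F(p, y) = ε log(∑_b exp(y b / ε)) + ε H(p) − ∑_a p a · y a`, one has
`F(p, y) ≥ (ε/2) (∑_a |p a − σ(y)(a)|)²`; in particular
`F(p, y) ≥ (ε/2) ∑_a (p a − σ(y)(a))²`. -/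
theorem fenchel_coupling_lower_bound {A : Type*} [Fintype A] [Nonempty A]
    (ε : ℝ) (hε : 0 < ε) (y : A → ℝ)
    (p : A → ℝ) (hp0 : ∀ a, 0 ≤ p a) (hp1 : ∑ a, p a = 1) :
    (ε / 2) * (∑ a, |p a - softmax ε y a|) ^ 2 ≤
        ε * Real.log (∑ b, Real.exp (y b / ε)) + ε * negEnt p - ∑ a, p a * y a ∧
    (ε / 2) * (∑ a, (p a - softmax ε y a) ^ 2) ≤
        ε * Real.log (∑ b, Real.exp (y b / ε)) + ε * negEnt p - ∑ a, p a * y a := by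
  have hZ : 0 < ∑ b, Real.exp (y b / ε) :=
    Finset.sum_pos (fun b _ => Real.exp_pos _) Finset.univ_nonempty
  have hq : ∀ a, 0 < softmax ε y a := fun a => div_pos (Real.exp_pos _) hZ
  have hq1 : ∑ a, softmax ε y a = 1 := by
    simp only [softmax]
    rw [← Finset.sum_div, div_self hZ.ne']
  have h := aux_pinsker p (softmax ε y) hp0 hq hp1 hq1
  have e : ε * ∑ a, (p a * Real.log (p a) - p a * Real.log (softmax ε y a)) =
      ε * Real.log (∑ b, Real.exp (y b / ε)) + ε * negEnt p - ∑ a, p a * y a := by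
    have e2 : ∀ a, p a * Real.log (softmax ε y a) =
        p a * y a / ε - p a * Real.log (∑ b, Real.exp (y b / ε)) := fun a => by
      rw [softmax, Real.log_div (Real.exp_pos _).ne' hZ.ne', Real.log_exp]; ring
    simp only [e2, negEnt]
    rw [Finset.sum_sub_distrib, Finset.sum_sub_distrib, ← Finset.sum_mul, hp1, ← Finset.sum_div]
    field_simp
    ring
  have m : (ε / 2) * (∑ a, |p a - softmax ε y a|) ^ 2 ≤
        ε * Real.log (∑ b, Real.exp (y b / ε)) + ε * negEnt p - ∑ a, p a * y a := by
    rw [← e]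
    nlinarith
  refine ⟨m, le_trans ?_ m⟩
  have h3 : ∑ a, (p a - softmax ε y a)^2 ≤ (∑ a, |p a - softmax ε y a|)^2 := by
    have := Finset.sum_sq_le_sq_sum_of_nonneg (s := Finset.univ) (f := fun a => |p a - softmax ε y a|) (fun a _ => abs_nonneg _)
    simpa only [sq_abs] using this
  exact mul_le_mul_of_nonneg_left h3 (by positivity)
end
end
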